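/- There exist absolute constants 0 < c ≤ C < ∞ such that for every α ∈ (0, 1/2] and every t with 0 < t < α^{α/(1−α)}, one has c·t^{1−α} ≤ F_α(t) ≤ C·t^{1−α}. In other words, F_α(t) = Θ(t^{1−α}) uniformly over α ∈ (0,1/2] in this range of t. -/

import Mathlib

open Real

/-- `Q α u₁ u₂ = (sin(α u₂)/sin(α u₁))^{α/(1−α)} · (sin u₁/sin u₂)^{1/(1−α)}
· sin((1−α)u₂)/sin((1−α)u₁)`. -/
noncomputable def Q (α u₁ u₂ : ℝ) : ℝ :=
  (Real.sin (α * u₂) / Real.sin (α * u₁)) ^ (α / (1 - α)) *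
    (Real.sin u₁ / Real.sin u₂) ^ (1 / (1 - α)) *
    (Real.sin ((1 - α) * u₂) / Real.sin ((1 - α) * u₁))

/-- `F_α(t) = (1/π²) ∫₀^π ∫₀^π 1/(1 + Q_α(u₁,u₂)/t) du₁ du₂`. -/
noncomputable def F (α t : ℝ) : ℝ :=
  (1 / Real.pi ^ 2) *
    ∫ u₁ in (0:ℝ)..Real.pi, ∫ u₂ in (0:ℝ)..Real.pi, 1 / (1 + Q α u₁ u₂ / t)


lemma my_sin_ge {u : ℝ} (h0 : 0 < u) (h1 : u < π) : u * (π - u) / 5 ≤ sin u := by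
  have hp := Real.pi_lt_d2
  have hp3 := Real.pi_gt_three
  have key : ∀ x : ℝ, 0 ≤ x → x ≤ π / 2 → x * (π - x) / 5 ≤ sin x := by
    intro x hx0 hx
    have h := Real.mul_le_sin hx0 hx
    refine le_trans ?_ h
    have h2 : (π - x) / 5 ≤ 2 / π := by
      rw [div_le_div_iff₀ (by norm_num) (by positivity)]
      nlinarith
    nlinarith
  rcases le_total u (π / 2) with h | h
  · exact key u h0.le h
  · have := key (π - u) (by linarith) (by linarith)
    rw [Real.sin_pi_sub] at this
    nlinarith

lemma my_sin_mul_ge {a u : ℝ} (ha0 : 0 ≤ a) (ha : a ≤ 1) (h0 : 0 ≤ u) (h1 : u ≤ π) :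
    a * sin u ≤ sin (a * u) := by
  have := strictConcaveOn_sin_Icc.concaveOn.2 (⟨le_rfl, Real.pi_pos.le⟩ : (0:ℝ) ∈ Set.Icc 0 π)
    (⟨h0, h1⟩ : u ∈ Set.Icc 0 π) (sub_nonneg.2 ha) ha0 (by ring)
  simpa using this

lemma rpow_le_base {x b : ℝ} (hx : 1 ≤ x) (hb1 : b ≤ 1) : x ^ b ≤ x := by
  simpa using Real.rpow_le_rpow_of_exponent_le hx hb1

lemma Q_eq {a u₁ u₂ : ℝ} (ha0 : 0 < a) (ha : a ≤ 1/2) (h1 : 0 < u₁) (h1' : u₁ < π)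
    (h2 : 0 < u₂) (h2' : u₂ < π) :
    Q a u₁ u₂ = ((sin u₁ / sin (a * u₁)) ^ (a / (1 - a)) * (sin u₁ / sin ((1 - a) * u₁))) *
      ((sin (a * u₂) / sin u₂) ^ (a / (1 - a)) * (sin ((1 - a) * u₂) / sin u₂)) := by
  have e : 1 / (1 - a) = a / (1 - a) + 1 := by
    have : 1 - a ≠ 0 := by linarith
    field_simp; ring
  have p1 : 0 < sin u₁ := sin_pos_of_pos_of_lt_pi h1 h1'
  have p2 : 0 < sin u₂ := sin_pos_of_pos_of_lt_pi h2 h2'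
  have p3 : 0 < sin (a * u₁) := sin_pos_of_pos_of_lt_pi (by positivity) (by nlinarith)
  have p4 : 0 < sin (a * u₂) := sin_pos_of_pos_of_lt_pi (by positivity) (by nlinarith)
  unfold Q
  rw [e, Real.rpow_add (by positivity), Real.rpow_one, Real.div_rpow p4.le p3.le,
    Real.div_rpow p1.le p2.le, Real.div_rpow p1.le p3.le, Real.div_rpow p4.le p2.le]
  ring

lemma beta_bd {a : ℝ} (ha0 : 0 < a) (ha : a ≤ 1/2) : 0 < a / (1 - a) ∧ a / (1 - a) ≤ 1 := by
  have : 0 < 1 - a := by linarith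
  exact ⟨by positivity, by rw [div_le_one this]; linarith⟩

set_option maxHeartbeats 2000000 in
lemma Q_lower {a v u₂ : ℝ} (ha0 : 0 < a) (ha : a ≤ 1/2) (h1 : 0 < v) (h1' : v < π)
    (h2 : 0 < u₂) (h2' : u₂ < π) :
    v ^ (a / (1 - a)) * v / (200 * (v + a)) ≤ Q a (π - v) u₂ := by
  obtain ⟨hb0, hb1⟩ := beta_bd ha0 ha
  set b := a / (1 - a) with hb
  have hp := Real.pi_lt_d2
  have hp3 := Real.pi_gt_three
  have hu0 : 0 < π - v := by linarith
  have hu1 : π - v < π := by linarith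
  rw [Q_eq ha0 ha hu0 hu1 h2 h2', ← hb]
  have hsu := my_sin_ge hu0 hu1
  obtain ⟨u, hu⟩ : ∃ u, u = π - v := ⟨_, rfl⟩
  rw [← hu] at hsu hu0 hu1 ⊢
  have hv : π - u = v := by linarith
  rw [hv] at hsu
  have p1 : 0 < sin u := sin_pos_of_pos_of_lt_pi hu0 hu1
  have p4 : 0 < sin (a * u₂) := sin_pos_of_pos_of_lt_pi (by positivity) (by nlinarith)
  have p2 : 0 < sin u₂ := sin_pos_of_pos_of_lt_pi h2 h2'
  have p3 : 0 < sin (a * u) := sin_pos_of_pos_of_lt_pi (by positivity) (by nlinarith)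
  have p5 : 0 < sin ((1 - a) * u) := sin_pos_of_pos_of_lt_pi (by nlinarith) (by nlinarith)
  have A1 : a ≤ sin (a * u₂) / sin u₂ := by
    rw [le_div_iff₀ p2]; exact my_sin_mul_ge ha0.le (by linarith) h2.le h2'.le
  have A2 : 1 / 2 ≤ sin ((1 - a) * u₂) / sin u₂ := by
    rw [le_div_iff₀ p2]
    have := my_sin_mul_ge (a := 1 - a) (by linarith) (by linarith) h2.le h2'.le
    nlinarith
  have A3 : v / 5 / a ≤ sin u / sin (a * u) := by
    rw [div_le_div_iff₀ ha0 p3]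
    have : sin (a * u) ≤ a * u := Real.sin_le (by positivity)
    nlinarith
  have A4 : v / (20 * (v + a)) ≤ sin u / sin ((1 - a) * u) := by
    rw [div_le_div_iff₀ (by positivity) p5]
    have : sin ((1 - a) * u) ≤ 4 * u * (v + a) := by
      rcases le_total u 1 with h | h
      · have : sin ((1 - a) * u) ≤ (1 - a) * u := Real.sin_le (by nlinarith)
        nlinarith
      · have : sin ((1 - a) * u) ≤ v + a * u := by
          rw [← Real.sin_pi_sub]
          refine (Real.sin_le (by nlinarith)).trans (by nlinarith)
        nlinarith
    nlinarith
  have B1 : a ^ b ≤ (sin (a * u₂) / sin u₂) ^ b := Real.rpow_le_rpow ha0.le A1 hb0.le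
  have B3 : v ^ b / 5 / a ^ b ≤ (sin u / sin (a * u)) ^ b := by
    refine le_trans ?_ (Real.rpow_le_rpow (by positivity) A3 hb0.le)
    rw [Real.div_rpow (by positivity) ha0.le, Real.div_rpow h1.le (by norm_num)]
    have : (5:ℝ) ^ b ≤ 5 := rpow_le_base (by norm_num) hb1
    gcongr
  calc v ^ b * v / (200 * (v + a)) = ((v ^ b / 5 / a ^ b) * (v / (20 * (v + a)))) * (a ^ b * (1 / 2)) := by
        have : a ^ b ≠ 0 := by positivity
        field_simp; norm_num
    _ ≤ _ := by gcongr

set_option maxHeartbeats 2000000 in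
lemma Q_upper {a v u₂ : ℝ} (ha0 : 0 < a) (ha : a ≤ 1/2) (h1 : 0 < v) (h1' : v < π)
    (h2 : 1 ≤ u₂) (h2' : u₂ ≤ 2) :
    Q a (π - v) u₂ ≤ 2000 * (v ^ (a / (1 - a)) * v / (v + a)) := by
  obtain ⟨hb0, hb1⟩ := beta_bd ha0 ha
  set b := a / (1 - a) with hb
  have hp := Real.pi_lt_d2
  have hp3 := Real.pi_gt_three
  have hu0 : 0 < π - v := by linarith
  have hu1 : π - v < π := by linarith
  have h20 : 0 < u₂ := by linarith
  have h2p : u₂ < π := by linarith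
  rw [Q_eq ha0 ha hu0 hu1 h20 h2p, ← hb]
  obtain ⟨u, hu⟩ : ∃ u, u = π - v := ⟨_, rfl⟩
  rw [← hu] at hu0 hu1 ⊢
  have hv : π - u = v := by linarith
  have p1 : 0 < sin u := sin_pos_of_pos_of_lt_pi hu0 hu1
  have p2 : 0 < sin u₂ := sin_pos_of_pos_of_lt_pi h20 h2p
  have p3 : 0 < sin (a * u) := sin_pos_of_pos_of_lt_pi (by positivity) (by nlinarith)
  have p4 : 0 < sin (a * u₂) := sin_pos_of_pos_of_lt_pi (by positivity) (by nlinarith)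
  have p5 : 0 < sin ((1 - a) * u) := sin_pos_of_pos_of_lt_pi (by nlinarith) (by nlinarith)
  have p6 : 0 < sin ((1 - a) * u₂) := sin_pos_of_pos_of_lt_pi (by nlinarith) (by nlinarith)
  have s2 : 1 / 5 ≤ sin u₂ := by
    have := my_sin_ge h20 h2p
    nlinarith
  have A1 : sin (a * u₂) / sin u₂ ≤ 10 * a := by
    rw [div_le_iff₀ p2]
    have : sin (a * u₂) ≤ a * u₂ := Real.sin_le (by positivity)
    nlinarith
  have A2 : sin ((1 - a) * u₂) / sin u₂ ≤ 5 := by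
    rw [div_le_iff₀ p2]
    have := Real.sin_le_one ((1 - a) * u₂)
    nlinarith
  have su : sin u ≤ u * v := by
    rcases le_total u 1 with h | h
    · have : sin u ≤ u := Real.sin_le hu0.le
      nlinarith
    · have : sin u ≤ v := by
        rw [← Real.sin_pi_sub, hv]; exact Real.sin_le h1.le
      nlinarith
  have A3 : sin u / sin (a * u) ≤ 2 * v / a := by
    rw [div_le_div_iff₀ p3 ha0]
    have : 2 / π * (a * u) ≤ sin (a * u) := Real.mul_le_sin (by positivity) (by nlinarith)
    have h3 : 1 / 2 ≤ 2 / π := by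
      rw [div_le_div_iff₀ (by norm_num) (by positivity)]; linarith
    have h4 : a * u / 2 ≤ sin (a * u) := by
      have : 0 < a * u := by positivity
      nlinarith
    nlinarith
  have A4 : sin u / sin ((1 - a) * u) ≤ 20 * v / (v + a) := by
    rw [div_le_div_iff₀ p5 (by positivity)]
    have h := my_sin_ge (u := (1 - a) * u) (by nlinarith) (by nlinarith)
    have h3 : (v + a) / 2 ≤ π - (1 - a) * u := by nlinarith
    have h4 : u / 2 ≤ (1 - a) * u := by nlinarith
    have h5 : u / 2 * ((v + a) / 2) / 5 ≤ sin ((1 - a) * u) := by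
      refine le_trans ?_ h
      gcongr
      nlinarith
    have : 0 < v + a := by positivity
    nlinarith
  have B1 : (sin (a * u₂) / sin u₂) ^ b ≤ 10 * a ^ b := by
    refine le_trans (Real.rpow_le_rpow (by positivity) A1 hb0.le) ?_
    rw [Real.mul_rpow (by norm_num) ha0.le]
    have : (10:ℝ) ^ b ≤ 10 := rpow_le_base (by norm_num) hb1
    gcongr
  have B3 : (sin u / sin (a * u)) ^ b ≤ 2 * v ^ b / a ^ b := by
    refine le_trans (Real.rpow_le_rpow (by positivity) A3 hb0.le) ?_
    rw [Real.div_rpow (by positivity) ha0.le, Real.mul_rpow (by norm_num) h1.le]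
    have : (2:ℝ) ^ b ≤ 2 := rpow_le_base (by norm_num) hb1
    gcongr
  calc _ ≤ ((2 * v ^ b / a ^ b) * (20 * v / (v + a))) * (10 * a ^ b * 5) := by gcongr
    _ = _ := by
        have : a ^ b ≠ 0 := by positivity
        field_simp; norm_num

lemma Q_nonneg {a u₁ u₂ : ℝ} (ha0 : 0 < a) (ha : a ≤ 1/2) (h1 : 0 ≤ u₁) (h1' : u₁ ≤ π)
    (h2 : 0 ≤ u₂) (h2' : u₂ ≤ π) : 0 ≤ Q a u₁ u₂ := by
  have s : ∀ c u : ℝ, 0 ≤ c → c ≤ 1 → 0 ≤ u → u ≤ π → 0 ≤ sin (c * u) := fun c u h h' h1 h2 =>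
    sin_nonneg_of_nonneg_of_le_pi (by positivity) (by nlinarith)
  have p1 := s a u₁ ha0.le (by linarith) h1 h1'
  have p2 := s a u₂ ha0.le (by linarith) h2 h2'
  have p3 := s (1 - a) u₁ (by linarith) (by linarith) h1 h1'
  have p4 := s (1 - a) u₂ (by linarith) (by linarith) h2 h2'
  have p5 := sin_nonneg_of_nonneg_of_le_pi h1 h1'
  have p6 := sin_nonneg_of_nonneg_of_le_pi h2 h2'
  unfold Q
  positivity

lemma f_bd {a t u₁ u₂ : ℝ} (ha0 : 0 < a) (ha : a ≤ 1/2) (ht : 0 < t) (h1 : 0 ≤ u₁) (h1' : u₁ ≤ π)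
    (h2 : 0 ≤ u₂) (h2' : u₂ ≤ π) : 0 ≤ 1 / (1 + Q a u₁ u₂ / t) ∧ 1 / (1 + Q a u₁ u₂ / t) ≤ 1 := by
  have h := Q_nonneg ha0 ha h1 h1' h2 h2'
  have : 0 ≤ Q a u₁ u₂ / t := by positivity
  exact ⟨by positivity, by rw [div_le_one (by positivity)]; linarith⟩

lemma f_upper {a t v u₂ : ℝ} (ha0 : 0 < a) (ha : a ≤ 1/2) (ht : 0 < t) (h1 : 0 < v) (h1' : v < π)
    (h2 : 0 < u₂) (h2' : u₂ < π) :
    1 / (1 + Q a (π - v) u₂ / t) ≤ 400 * t * (2 + a * v ^ (-1 - a / (1 - a))) := by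
  have hQ := Q_lower ha0 ha h1 h1' h2 h2'
  obtain ⟨hb0, hb1⟩ := beta_bd ha0 ha
  set b := a / (1 - a) with hb
  have hvb : 0 < v ^ b := by positivity
  have e : v ^ (-1 - b) = 1 / (v ^ b * v) := by
    rw [show -1 - b = -(b + 1) by ring, Real.rpow_neg h1.le, Real.rpow_add h1, Real.rpow_one]
    simp
  have hg : 0 < v ^ b * v / (200 * (v + a)) := by positivity
  have hab : (1 / a) ^ b ≤ 2 := by
    have h := rpow_one_add_le_one_add_mul_self (s := 1 / a - 1)
      (by have : 0 < 1 / a := by positivity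
          linarith) hb0.le hb1
    have e1 : b * (1 / a - 1) = 1 := by
      rw [hb]
      have : 1 - a ≠ 0 := by linarith
      field_simp
    rw [e1] at h
    simpa [show (1:ℝ) + 1 = 2 by norm_num] using h
  have hk : (v + a) / (v ^ b * v) ≤ 2 * (2 + a * v ^ (-1 - b)) := by
    rw [e]
    have hx : 0 < 1 / (v ^ b * v) := by positivity
    rcases le_total v a with h | h
    · have : (v + a) / (v ^ b * v) ≤ (2 * a) * (1 / (v ^ b * v)) := by
        rw [mul_one_div]; gcongr; linarith
      linarith
    · have h3 : (v + a) / (v ^ b * v) ≤ 2 * (1 / v ^ b) := by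
        rw [mul_one_div, div_le_div_iff₀ (by positivity) hvb]
        nlinarith
      have h4 : 1 / v ^ b ≤ (1 / a) ^ b := by
        rw [Real.div_rpow (by norm_num) ha0.le, Real.one_rpow]
        gcongr
      have : 0 < a * (1 / (v ^ b * v)) := by positivity
      linarith
  calc 1 / (1 + Q a (π - v) u₂ / t) ≤ 1 / ((v ^ b * v / (200 * (v + a))) / t) := by
        gcongr
        have : v ^ b * v / (200 * (v + a)) / t ≤ Q a (π - v) u₂ / t := by gcongr
        linarith
    _ = 200 * t * ((v + a) / (v ^ b * v)) := by field_simp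
    _ ≤ 200 * t * (2 * (2 + a * v ^ (-1 - b))) := by gcongr
    _ = _ := by ring

lemma f_lower1 {a t v u₂ : ℝ} (ha0 : 0 < a) (ha : a ≤ 1/2) (ht : 0 < t) (h1 : 0 < v) (h1' : v < π)
    (h2 : 1 ≤ u₂) (h2' : u₂ ≤ 2) (hv : t ^ (1 - a) ≤ v) :
    t / 4000 * (a * v ^ (-1 - a / (1 - a))) ≤ 1 / (1 + Q a (π - v) u₂ / t) := by
  have hQ := Q_upper ha0 ha h1 h1' h2 h2'
  have hQ0 := Q_nonneg (u₁ := π - v) (u₂ := u₂) ha0 ha (by linarith) (by linarith) (by linarith)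
    (by linarith [Real.pi_gt_three])
  obtain ⟨hb0, hb1⟩ := beta_bd ha0 ha
  have hv2 : t ≤ v ^ (a / (1 - a)) * v := by
    have h := Real.rpow_le_rpow (by positivity) hv (z := a / (1 - a) + 1) (by positivity)
    rw [← Real.rpow_mul ht.le, Real.rpow_add h1, Real.rpow_one] at h
    have e : (1 - a) * (a / (1 - a) + 1) = 1 := by
      have : 1 - a ≠ 0 := by linarith
      field_simp; ring
    rwa [e, Real.rpow_one] at h
  set b := a / (1 - a) with hb
  have hvb : 0 < v ^ b := by positivity
  have e : v ^ (-1 - b) = 1 / (v ^ b * v) := by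
    rw [show -1 - b = -(b + 1) by ring, Real.rpow_neg h1.le, Real.rpow_add h1, Real.rpow_one]
    simp
  rw [e]
  set w := v ^ b * v with hw
  have hw0 : 0 < w := by positivity
  have hQ2 : Q a (π - v) u₂ ≤ 2000 * (w / a) := by
    refine hQ.trans ?_
    gcongr
    linarith
  have hta : t ≤ w / a := by
    rw [le_div_iff₀ ha0]; nlinarith
  rw [show t / 4000 * (a * (1 / w)) = 1 / (4000 * (w / a) / t) by field_simp]
  gcongr
  rw [le_div_iff₀ ht, add_mul, div_mul_cancel₀ _ ht.ne']
  linarith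

lemma f_lower2 {a t v u₂ : ℝ} (ha0 : 0 < a) (ha : a ≤ 1/2) (ht : 0 < t) (ht1 : t ≤ 1)
    (h1 : 1 ≤ v) (h1' : v ≤ 2)
    (h2 : 1 ≤ u₂) (h2' : u₂ ≤ 2) :
    t / 8000 ≤ 1 / (1 + Q a (π - v) u₂ / t) := by
  have hp3 := Real.pi_gt_three
  have hQ := Q_upper (v := v) ha0 ha (by linarith) (by linarith) h2 h2'
  have hQ0 := Q_nonneg (u₁ := π - v) (u₂ := u₂) ha0 ha (by linarith) (by linarith) (by linarith)
    (by linarith)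
  obtain ⟨hb0, hb1⟩ := beta_bd ha0 ha
  set b := a / (1 - a) with hb
  have h3 : v ^ b ≤ 2 := (rpow_le_base h1 hb1).trans h1'
  have h4 : v ^ b * v / (v + a) ≤ 2 := by
    rw [div_le_iff₀ (by positivity)]
    nlinarith
  rw [show t / 8000 = 1 / (8000 / t) by field_simp]
  gcongr
  rw [le_div_iff₀ ht, add_mul, div_mul_cancel₀ _ ht.ne']
  linarith

open MeasureTheory

lemma f_meas (a t : ℝ) : Measurable (fun p : ℝ × ℝ => 1 / (1 + Q a p.1 p.2 / t)) := by
  unfold Q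
  fun_prop

lemma f_int {a t u : ℝ} (ha0 : 0 < a) (ha : a ≤ 1/2) (ht : 0 < t) (h1 : 0 ≤ u) (h1' : u ≤ π) :
    IntervalIntegrable (fun u₂ => 1 / (1 + Q a u u₂ / t)) volume 0 π := by
  rw [intervalIntegrable_iff_integrableOn_Ioc_of_le Real.pi_pos.le]
  refine Measure.integrableOn_of_bounded (M := 1) (by simp) ?_ ?_
  · exact ((f_meas a t).comp (measurable_const.prodMk measurable_id)).aestronglyMeasurable
  · refine (ae_restrict_mem measurableSet_Ioc).mono fun x hx => ?_
    have := f_bd ha0 ha ht h1 h1' hx.1.le hx.2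
    rw [Real.norm_eq_abs, abs_le]
    exact ⟨by linarith, this.2⟩

/-- inner integral -/
noncomputable def hh (a t u : ℝ) : ℝ := ∫ u₂ in (0:ℝ)..π, 1 / (1 + Q a u u₂ / t)

lemma hh_bd {a t u : ℝ} (ha0 : 0 < a) (ha : a ≤ 1/2) (ht : 0 < t) (h1 : 0 ≤ u) (h1' : u ≤ π) :
    0 ≤ hh a t u ∧ hh a t u ≤ π := by
  constructor
  · exact intervalIntegral.integral_nonneg Real.pi_pos.le
      fun x hx => (f_bd ha0 ha ht h1 h1' hx.1 hx.2).1
  · have := intervalIntegral.integral_mono_on Real.pi_pos.le (f_int ha0 ha ht h1 h1')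
      (intervalIntegrable_const (c := (1:ℝ))) fun x hx => (f_bd ha0 ha ht h1 h1' hx.1 hx.2).2
    simpa [hh] using this

lemma hh_int {a t : ℝ} (ha0 : 0 < a) (ha : a ≤ 1/2) (ht : 0 < t) :
    IntervalIntegrable (fun v => hh a t (π - v)) volume 0 π := by
  rw [intervalIntegrable_iff_integrableOn_Ioc_of_le Real.pi_pos.le]
  refine Measure.integrableOn_of_bounded (M := π) (by simp) ?_ ?_
  · have hm : StronglyMeasurable (hh a t) := by
      have := (f_meas a t).stronglyMeasurable.integral_prod_right'
        (ν := volume.restrict (Set.Ioc 0 π))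
      convert this using 2
      simp [hh, intervalIntegral.integral_of_le Real.pi_pos.le]
    exact (hm.measurable.comp (measurable_const.sub measurable_id)).aestronglyMeasurable
  · refine (ae_restrict_mem measurableSet_Ioc).mono fun x hx => ?_
    have := hh_bd (u := π - x) ha0 ha ht (by linarith [hx.2]) (by linarith [hx.1])
    rw [Real.norm_eq_abs, abs_le]
    exact ⟨by linarith [Real.pi_pos], this.2⟩

lemma F_eq (a t : ℝ) : F a t = 1 / π ^ 2 * ∫ v in (0:ℝ)..π, hh a t (π - v) := by
  rw [intervalIntegral.integral_comp_sub_left (fun u => hh a t u)]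
  simp [F, hh]

lemma hh_upper {a t v : ℝ} (ha0 : 0 < a) (ha : a ≤ 1/2) (ht : 0 < t) (h1 : 0 < v) (h1' : v < π) :
    hh a t (π - v) ≤ π * (400 * t * (2 + a * v ^ (-1 - a / (1 - a)))) := by
  have := intervalIntegral.integral_mono_on_of_le_Ioo Real.pi_pos.le
    (f_int (u := π - v) ha0 ha ht (by linarith) (by linarith))
    (intervalIntegrable_const (c := 400 * t * (2 + a * v ^ (-1 - a / (1 - a)))))
    fun x hx => f_upper ha0 ha ht h1 h1' hx.1 hx.2
  rw [intervalIntegral.integral_const, smul_eq_mul, sub_zero] at this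
  exact this

lemma hh_lower {a t v m : ℝ} (ha0 : 0 < a) (ha : a ≤ 1/2) (ht : 0 < t) (h1 : 0 ≤ v) (h1' : v ≤ π)
    (hm : ∀ x ∈ Set.Icc (1:ℝ) 2, m ≤ 1 / (1 + Q a (π - v) x / t)) :
    m ≤ hh a t (π - v) := by
  have hp3 := Real.pi_gt_three
  have hi := f_int (u := π - v) ha0 ha ht (by linarith) (by linarith)
  have hsub : Set.uIcc (1:ℝ) 2 ⊆ Set.uIcc 0 π := by
    rw [Set.uIcc_of_le (by norm_num), Set.uIcc_of_le (by linarith)]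
    exact Set.Icc_subset_Icc (by norm_num) (by linarith)
  have := intervalIntegral.integral_mono_on (by norm_num : (1:ℝ) ≤ 2)
    (intervalIntegrable_const (c := m)) (hi.mono_set hsub) hm
  have h2 : ∫ x in (1:ℝ)..2, 1 / (1 + Q a (π - v) x / t) ≤ hh a t (π - v) := by
    refine intervalIntegral.integral_mono_interval (by norm_num) (by norm_num) (by linarith) ?_ hi
    refine (ae_restrict_mem measurableSet_Ioc).mono fun x hx => ?_
    exact (f_bd ha0 ha ht (by linarith) (by linarith) hx.1.le hx.2).1
  refine le_trans ?_ h2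
  refine le_trans ?_ this
  simp; norm_num

lemma pow_int {a p q : ℝ} (ha0 : 0 < a) (ha : a ≤ 1/2) (hp : 0 < p) (hq : p ≤ q) :
    IntervalIntegrable (fun v : ℝ => v ^ (-1 - a / (1 - a))) volume p q ∧
    ∫ v in p..q, a * v ^ (-1 - a / (1 - a)) =
      (1 - a) * (p ^ (-(a / (1 - a))) - q ^ (-(a / (1 - a)))) := by
  obtain ⟨hb0, hb1⟩ := beta_bd ha0 ha
  have h0 : (0:ℝ) ∉ Set.uIcc p q := by
    rw [Set.uIcc_of_le hq]; intro h; linarith [h.1]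
  refine ⟨intervalIntegral.intervalIntegrable_rpow (Or.inr h0), ?_⟩
  rw [intervalIntegral.integral_const_mul, integral_rpow (Or.inr ⟨by linarith, h0⟩)]
  rw [show -1 - a / (1 - a) + 1 = -(a / (1 - a)) by ring]
  have : 1 - a ≠ 0 := by linarith
  field_simp
  ring

/-- There exist absolute constants `0 < c ≤ C < ∞` such that for every `α ∈ (0, 1/2]` and every
`t` with `0 < t < α^{α/(1−α)}`, one has `c·t^{1−α} ≤ F_α(t) ≤ C·t^{1−α}`; i.e.
`F_α(t) = Θ(t^{1−α})` uniformly over `α ∈ (0, 1/2]` in this range of `t`. -/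
theorem stmt_7 :
    ∃ c C : ℝ, 0 < c ∧ c ≤ C ∧
      ∀ α ∈ Set.Ioc (0:ℝ) (1/2), ∀ t : ℝ, 0 < t → t < α ^ (α / (1 - α)) →
        c * t ^ (1 - α) ≤ F α t ∧ F α t ≤ C * t ^ (1 - α) := by
  have hp := Real.pi_lt_d2
  have hp3 := Real.pi_gt_three
  refine ⟨1 / π ^ 2 * (1 / 16000), 1 / π ^ 2 * (20000), by positivity, ?_, ?_⟩
  · gcongr; norm_num
  rintro a ⟨ha0, ha⟩ t ht hta
  obtain ⟨hb0, hb1⟩ := beta_bd ha0 ha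
  have ht1 : t ≤ 1 := hta.le.trans (Real.rpow_le_one ha0.le (by linarith) hb0.le)
  rw [F_eq]
  set s := t ^ (1 - a) with hs
  have hs0 : 0 < s := by positivity
  have hs1 : s ≤ 1 := Real.rpow_le_one ht.le ht1 (by linarith)
  have hts : t ≤ s := by
    simpa using Real.rpow_le_rpow_of_exponent_ge ht ht1 (by linarith : 1 - a ≤ 1)
  have hsb : t * s ^ (-(a / (1 - a))) = s := by
    rw [hs, ← Real.rpow_mul ht.le]
    have : (1 - a) * (-(a / (1 - a))) = -a := by
      have : 1 - a ≠ 0 := by linarith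
      field_simp
    rw [this]
    nth_rewrite 1 [← Real.rpow_one t]
    rw [← Real.rpow_add ht]; rfl
  have hi := hh_int ha0 ha ht
  have sub : ∀ p q : ℝ, 0 ≤ p → p ≤ q → q ≤ π →
      IntervalIntegrable (fun v => hh a t (π - v)) volume p q := by
    intro p q h1 h2 h3
    refine hi.mono_set ?_
    rw [Set.uIcc_of_le h2, Set.uIcc_of_le (by linarith)]
    exact Set.Icc_subset_Icc h1 h3
  rw [mul_assoc, mul_assoc]
  constructor
  · gcongr
    have i1 := pow_int ha0 ha hs0 hs1
    have m1 : t / 8000 * ∫ v in s..1, a * v ^ (-1 - a / (1 - a)) ≤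
        ∫ v in s..1, hh a t (π - v) := by
      rw [← intervalIntegral.integral_const_mul]
      refine intervalIntegral.integral_mono_on hs1 ((i1.1.const_mul _).const_mul _)
        (sub _ _ hs0.le hs1 (by linarith)) fun v hv => ?_
      have hv0 : 0 < v := by linarith [hv.1]
      refine hh_lower ha0 ha ht hv0.le (by linarith [hv.2]) fun x hx => ?_
      refine le_trans ?_ (f_lower1 ha0 ha ht hv0 (by linarith [hv.2]) hx.1 hx.2 hv.1)
      gcongr
      norm_num
    have m2 : t / 8000 ≤ ∫ v in (1:ℝ)..2, hh a t (π - v) := by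
      have := intervalIntegral.integral_mono_on (by norm_num : (1:ℝ) ≤ 2)
        (intervalIntegrable_const (c := t / 8000))
        (sub 1 2 (by norm_num) (by norm_num) (by linarith)) fun v hv => 
          hh_lower ha0 ha ht (by linarith [hv.1]) (by linarith [hv.2]) fun x hx => 
            f_lower2 ha0 ha ht ht1 hv.1 hv.2 hx.1 hx.2
      refine le_trans ?_ this
      simp; norm_num
    have m3 : ∫ v in s..2, hh a t (π - v) ≤ ∫ v in (0:ℝ)..π, hh a t (π - v) := by
      refine intervalIntegral.integral_mono_interval hs0.le (by linarith) (by linarith) ?_ hi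
      refine (ae_restrict_mem measurableSet_Ioc).mono fun x hx => ?_
      exact (hh_bd ha0 ha ht (by linarith [hx.2]) (by linarith [hx.1])).1
    rw [← intervalIntegral.integral_add_adjacent_intervals (sub s 1 hs0.le hs1 (by linarith))
      (sub 1 2 (by norm_num) (by norm_num) (by linarith))] at m3
    rw [i1.2, Real.one_rpow] at m1
    have e : t / 8000 * ((1 - a) * (s ^ (-(a / (1 - a))) - 1)) = (1 - a) * (s - t) / 8000 := by
      rw [← hsb]; simp only [hsb]
      linear_combination (1 - a) / 8000 * hsb
    rw [e] at m1
    nlinarith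
  · gcongr
    have hsp : s ≤ π := by linarith
    have i1 := pow_int ha0 ha hs0 hsp
    rw [← intervalIntegral.integral_add_adjacent_intervals (sub 0 s le_rfl hs0.le hsp)
      (sub s π hs0.le hsp le_rfl)]
    have m1 : ∫ v in (0:ℝ)..s, hh a t (π - v) ≤ s * π := by
      have := intervalIntegral.integral_mono_on hs0.le (sub 0 s le_rfl hs0.le hsp)
        (intervalIntegrable_const (c := π)) fun v hv => 
          (hh_bd ha0 ha ht (by linarith [hv.2]) (by linarith [hv.1])).2
      simpa using this
    have m2 : ∫ v in s..π, hh a t (π - v) ≤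
        ∫ v in s..π, π * (400 * t * (2 + a * v ^ (-1 - a / (1 - a)))) := by
      refine intervalIntegral.integral_mono_on_of_le_Ioo hsp (sub s π hs0.le hsp le_rfl)
        (((intervalIntegrable_const).add (i1.1.const_mul _)).const_mul _ |>.const_mul _)
        fun v hv => hh_upper ha0 ha ht (by linarith [hv.1]) hv.2
    rw [intervalIntegral.integral_const_mul, intervalIntegral.integral_const_mul,
      intervalIntegral.integral_add intervalIntegrable_const (i1.1.const_mul _), i1.2] at m2
    simp only [intervalIntegral.integral_const, smul_eq_mul] at m2
    have hpp : 0 < π ^ (-(a / (1 - a))) := by positivity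
    have hss : 0 < s ^ (-(a / (1 - a))) := by positivity
    have k1 : (π - s) * 2 + (1 - a) * (s ^ (-(a / (1 - a))) - π ^ (-(a / (1 - a)))) ≤
        7 + s ^ (-(a / (1 - a))) := by nlinarith
    have k2 : t * ((π - s) * 2 + (1 - a) * (s ^ (-(a / (1 - a))) - π ^ (-(a / (1 - a))))) ≤
        8 * s := by nlinarith
    have k3 : ∫ v in s..π, hh a t (π - v) ≤ π * 400 * (8 * s) := by
      refine m2.trans ?_
      rw [mul_assoc 400 t, ← mul_assoc]
      gcongr
    nlinarith
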